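/- Let 𝒯=(V,ℰ) be a leafless, locally finite rooted directed tree, let q be a positive integer, and let S_{λ,q} be the Dirichlet shift on ℓ²(V). Then S_{λ,q} is a q-isometry, that is, Σ_{k=0}^{q} (−1)^k (q choose k) S_{λ,q}^{*k} S_{λ,q}^{k} = 0; moreover, if q ≥ 2 then S_{λ,q} is not a (q−1)-isometry, that is, Σ_{k=0}^{q−1} (−1)^k ((q−1) choose k) S_{λ,q}^{*k} S_{λ,q}^{k} ≠ 0. -/

import Mathlib

open scoped ENNReal InnerProductSpace
open ContinuousLinearMap

noncomputable section

/-- A (countably infinite) rooted directed tree. -/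
structure DirTree (V : Type) where
  edge : V → V → Prop
  not_self : ∀ v, ¬ edge v v
  no_circuit : ∀ v, ¬ Relation.TransGen edge v v
  connected : ∀ u v : V, Relation.ReflTransGen (fun a b => edge a b ∨ edge b a) u v
  uniq_parent : ∀ {u w v : V}, edge u v → edge w v → u = w
  root : V
  root_no_parent : ∀ u, ¬ edge u root
  root_uniq : ∀ v, (∀ u, ¬ edge u v) → v = root

namespace DirTree

variable {V : Type} (T : DirTree V)

/-- The set of children of a vertex. -/
def chi (v : V) : Set V := {u | T.edge v u}

/-- Leafless: every vertex has a child. -/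
def Leafless : Prop := ∀ v : V, ∃ u, T.edge v u

/-- Locally finite: every vertex has finitely many children. -/
def LocFin : Prop := ∀ v : V, (T.chi v).Finite

/-- The finset of children of a vertex (locally finite case). -/
def chiFin (hT : T.LocFin) (v : V) : Finset V := (hT v).toFinset

/-- Iterated child sets `Chi^⟨n⟩(W)`. -/
def chiIter (T : DirTree V) : ℕ → Set V → Set V
  | 0, W => W
  | n + 1, W => {u | ∃ v ∈ chiIter T n W, T.edge v u}

/-- The depth of a vertex: the unique `n` with `v ∈ Chi^⟨n⟩(root)`. -/
def depth (v : V) : ℕ := sInf {n | v ∈ T.chiIter n {T.root}}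

/-- The parent map (junk value at the root). -/
def par (v : V) : V :=
  letI := Classical.propDecidable (∃ u, T.edge u v)
  if h : ∃ u, T.edge u v then h.choose else v

end DirTree

/-- `ℓ²(V)`. -/
abbrev l2 (V : Type) := lp (fun _ : V => ℂ) 2

/-- The standard orthonormal basis vector `e_v` of `ℓ²(V)`. -/
def evec {V : Type} (v : V) : l2 V :=
  letI := Classical.decEq V
  lp.single 2 v 1

/-- The Pochhammer symbol `(x)_k = x (x+1) ⋯ (x+k-1)`. -/
def poch (x : ℝ) (k : ℕ) : ℝ := ∏ i ∈ Finset.range k, (x + i)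

namespace DirTree

variable {V : Type} (T : DirTree V)

/-- The weight `λ_{u,q}` (for any child `u` of `v`). -/
def wt (hT : T.LocFin) (q : ℝ) (v : V) : ℝ :=
  Real.sqrt (((T.depth v : ℝ) + q) / ((T.depth v : ℝ) + 1)) /
    Real.sqrt ((T.chiFin hT v).card)

/-- `S` is the Dirichlet shift with parameter `q` on `ℓ²(V)`:
`S e_v = ∑_{u ∈ Chi(v)} λ_{u,q} e_u`. -/
def IsDirichletShift (hT : T.LocFin) (q : ℝ) (S : l2 V →L[ℂ] l2 V) : Prop :=
  ∀ v : V, S (evec v) = ∑ u ∈ T.chiFin hT v, ((T.wt hT q v : ℝ) : ℂ) • evec u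

end DirTree

/-- The Cauchy dual `S (S*S)⁻¹` of a left-invertible operator. -/
def cauchyDual {V : Type} (S : l2 V →L[ℂ] l2 V) : l2 V →L[ℂ] l2 V :=
  S * Ring.inverse (ContinuousLinearMap.adjoint S * S)

namespace DirTree

variable {V : Type} {T : DirTree V}

theorem mem_chiIter_unique {v : V} {m n : ℕ} (hm : v ∈ T.chiIter m {T.root})
    (hn : v ∈ T.chiIter n {T.root}) : m = n := by
  induction m generalizing v n with
  | zero =>
    obtain rfl : v = T.root := hm
    cases n with
    | zero => rfl
    | succ n =>
      obtain ⟨w, -, hw⟩ := hn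
      exact (T.root_no_parent w hw).elim
  | succ m ih =>
    obtain ⟨w, hwm, hw⟩ := hm
    cases n with
    | zero =>
      obtain rfl : v = T.root := hn
      exact (T.root_no_parent w hw).elim
    | succ n =>
      obtain ⟨w', hwn, hw'⟩ := hn
      obtain rfl := T.uniq_parent hw hw'
      rw [ih hwm hwn]

theorem exists_mem_chiIter (v : V) : ∃ n, v ∈ T.chiIter n {T.root} := by
  induction T.connected T.root v with
  | refl => exact ⟨0, rfl⟩
  | @tail a b _ hab ih =>
    obtain ⟨n, hn⟩ := ih
    rcases hab with hab | hba
    · exact ⟨n + 1, a, hn, hab⟩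
    · cases n with
      | zero =>
        obtain rfl : a = T.root := hn
        exact (T.root_no_parent b hba).elim
      | succ n =>
        obtain ⟨w, hwn, hw⟩ := hn
        obtain rfl := T.uniq_parent hw hba
        exact ⟨n, hwn⟩

theorem mem_chiIter_depth (v : V) : v ∈ T.chiIter (T.depth v) {T.root} :=
  Nat.sInf_mem (s := {n | v ∈ T.chiIter n {T.root}}) (exists_mem_chiIter v)

theorem depth_root : T.depth T.root = 0 :=
  mem_chiIter_unique (mem_chiIter_depth T.root) (n := 0) rfl

theorem depth_of_edge {v u : V} (h : T.edge v u) : T.depth u = T.depth v + 1 :=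
  mem_chiIter_unique (mem_chiIter_depth u) ⟨v, mem_chiIter_depth v, h⟩

theorem mem_chiFin {hT : T.LocFin} {v u : V} : u ∈ T.chiFin hT v ↔ T.edge v u := by
  simp [chiFin, chi]

theorem card_mul_wt_mul_wt (hL : T.Leafless) (hT : T.LocFin) {q : ℝ} (hq : 0 ≤ q) (v : V) :
    (T.chiFin hT v).card * (T.wt hT q v * T.wt hT q v) =
      ((T.depth v : ℝ) + q) / ((T.depth v : ℝ) + 1) := by
  obtain ⟨u, hu⟩ := hL v
  have hcard : ((T.chiFin hT v).card : ℝ) ≠ 0 :=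
    Nat.cast_ne_zero.2 (Finset.card_ne_zero_of_mem (mem_chiFin.2 hu))
  rw [wt, div_mul_div_comm, Real.mul_self_sqrt (by positivity), Real.mul_self_sqrt (by positivity)]
  field_simp

end DirTree

theorem inner_evec_left {V : Type} (v : V) (f : l2 V) : ⟪evec v, f⟫_ℂ = f v := by
  simp [evec, lp.inner_single_left]

theorem inner_evec_evec {V : Type} [DecidableEq V] (v w : V) :
    ⟪evec v, evec w⟫_ℂ = if v = w then 1 else 0 := by
  rw [inner_evec_left]
  rcases eq_or_ne v w with rfl | h
  · simp [evec]
  · simp [evec, h]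

theorem evec_ne_zero {V : Type} (v : V) : (evec v : l2 V) ≠ 0 := by
  classical
  intro h
  have := inner_evec_evec v v
  simp [h] at this

theorem l2_ext_inner {V : Type} {f g : l2 V} (h : ∀ v, ⟪evec v, f⟫_ℂ = ⟪evec v, g⟫_ℂ) :
    f = g := by
  ext v
  simpa [inner_evec_left] using h v

theorem clm_eq_zero_of_evec {V : Type} {A : l2 V →L[ℂ] l2 V} (h : ∀ v, A (evec v) = 0) :
    A = 0 := by
  have hadj : adjoint A = 0 := by
    ext1 f
    refine l2_ext_inner fun v => ?_
    rw [adjoint_inner_right, h]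
    simp
  simpa using congrArg adjoint hadj

theorem cast_choose_add_ne_zero (n p : ℕ) : ((n + p).choose p : ℂ) ≠ 0 :=
  Nat.cast_ne_zero.2 (Nat.choose_pos (Nat.le_add_left p n)).ne'

theorem choose_ratio_step (n p k : ℕ) :
    ((n + 1 + p + k).choose p : ℂ) / ((n + 1 + p).choose p : ℂ) *
        ((((n : ℝ) + ((p + 1 : ℕ) : ℝ)) / ((n : ℝ) + 1) : ℝ) : ℂ) =
      ((n + p + (k + 1)).choose p : ℂ) / ((n + p).choose p : ℂ) := by
  have hrec : ((n + 1 + p).choose p : ℂ) * (n + 1) = (n + p).choose p * (n + p + 1) := by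
    have h := Nat.choose_mul_succ_eq (n + p) p
    rw [Nat.sub_add_comm (Nat.le_add_left p n), Nat.add_sub_cancel, Nat.add_right_comm n p 1] at h
    have hcast := congrArg (Nat.cast : ℕ → ℂ) h
    push_cast at hcast
    linear_combination -hcast
  have h1 := cast_choose_add_ne_zero (n + 1) p
  have h2 := cast_choose_add_ne_zero n p
  have h3 : (n + 1 : ℂ) ≠ 0 := Nat.cast_add_one_ne_zero n
  rw [show n + p + (k + 1) = n + 1 + p + k by ring]
  push_cast
  rw [div_mul_div_comm, div_eq_div_iff (mul_ne_zero h1 h3) h2]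
  linear_combination -((n + 1 + p + k).choose p : ℂ) * hrec

namespace DirTree.IsDirichletShift

variable {V : Type} {T : DirTree V} {hT : T.LocFin} {S : l2 V →L[ℂ] l2 V}

theorem adjoint_evec {q : ℝ} (hS : T.IsDirichletShift hT q S) {v u : V} (h : T.edge v u) :
    adjoint S (evec u) = ((T.wt hT q v : ℝ) : ℂ) • evec v := by
  classical
  refine l2_ext_inner fun w => ?_
  rw [adjoint_inner_right, hS w, sum_inner, inner_smul_right, inner_evec_evec]
  simp only [inner_smul_left, inner_evec_evec, Complex.conj_ofReal, mul_ite, mul_one, mul_zero,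
    Finset.sum_ite_eq', mem_chiFin]
  by_cases hw : w = v
  · simp [hw, h]
  · rw [if_neg fun h' => hw (T.uniq_parent h' h), if_neg hw]

theorem adjoint_apply_evec {q : ℝ} (hL : T.Leafless) (hq : 0 ≤ q)
    (hS : T.IsDirichletShift hT q S) (v : V) :
    adjoint S (S (evec v)) =
      ((((T.depth v : ℝ) + q) / ((T.depth v : ℝ) + 1) : ℝ) : ℂ) • evec v := by
  rw [hS v, map_sum, Finset.sum_congr rfl fun u hu => by
    rw [map_smul, hS.adjoint_evec (mem_chiFin.1 hu), smul_smul],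
    Finset.sum_const, ← card_mul_wt_mul_wt hL hT hq, ← Nat.cast_smul_eq_nsmul ℂ, smul_smul]
  push_cast
  rfl

/-- The moments of the shift form the polynomial sequence
`k ↦ (n + k + p choose p) / (n + p choose p)` of degree `p`. -/
theorem adjoint_pow_mul_pow_evec {p : ℕ} (hL : T.Leafless)
    (hS : T.IsDirichletShift hT ((p + 1 : ℕ) : ℝ) S) (k : ℕ) (v : V) :
    (adjoint S ^ k * S ^ k) (evec v) =
      (((T.depth v + p + k).choose p : ℂ) / ((T.depth v + p).choose p : ℂ)) • evec v := by
  induction k generalizing v with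
  | zero =>
    have : ((T.depth v + p).choose p : ℂ) ≠ 0 :=
      cast_choose_add_ne_zero _ p
    simp [this]
  | succ k ih =>
    have hsplit : (adjoint S ^ (k + 1) * S ^ (k + 1)) (evec v) =
        adjoint S ((adjoint S ^ k * S ^ k) (S (evec v))) := by
      rw [pow_succ', pow_succ]
      rfl
    have hstep : (adjoint S ^ k * S ^ k) (S (evec v)) =
        (((T.depth v + 1 + p + k).choose p : ℂ) / ((T.depth v + 1 + p).choose p : ℂ)) •
          S (evec v) := by
      rw [hS v, map_sum, Finset.smul_sum]
      refine Finset.sum_congr rfl fun u hu => ?_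
      rw [map_smul, ih, depth_of_edge (mem_chiFin.1 hu), smul_comm]
    rw [hsplit, hstep, map_smul, hS.adjoint_apply_evec hL (by positivity), smul_smul]
    exact congrArg (· • evec v) (choose_ratio_step (T.depth v) p k)

end DirTree.IsDirichletShift

theorem sum_neg_one_pow_mul_choose_mul_choose (m j N : ℕ) :
    ∑ k ∈ Finset.range (m + 1), ((-1 : ℂ) ^ k * m.choose k) * (N + k).choose j =
      (-1) ^ m * (((fwdDiff 1)^[m] (fun x : ℕ => (x.choose j : ℤ)) N : ℤ) : ℂ) := by
  rw [fwdDiff_iter_eq_sum_shift, Int.cast_sum, Finset.mul_sum]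
  refine Finset.sum_congr rfl fun k hk => ?_
  have hkm : k ≤ m := by simpa [Nat.lt_succ_iff] using hk
  obtain ⟨d, rfl⟩ := Nat.exists_eq_add_of_le hkm
  have hd : ((-1 : ℂ) ^ d) * (-1) ^ d = 1 := by rw [← mul_pow]; simp
  simp only [Nat.add_sub_cancel_left, smul_eq_mul, mul_one, pow_add]
  push_cast
  linear_combination -((-1 : ℂ) ^ k * (k + d).choose k * (N + k).choose j) * hd

theorem sum_choose_eq_zero (p N : ℕ) :
    ∑ k ∈ Finset.range (p + 1 + 1), ((-1 : ℂ) ^ k * (p + 1).choose k) * (N + k).choose p = 0 := by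
  rw [sum_neg_one_pow_mul_choose_mul_choose, Function.iterate_succ_apply',
    show (fwdDiff 1)^[p] (fun x : ℕ => (x.choose p : ℤ)) = fun _ => 1 by
      simpa using fwdDiff_iter_choose 0 p]
  simp [fwdDiff]

theorem sum_choose_eq_neg_one_pow (p N : ℕ) :
    ∑ k ∈ Finset.range (p + 1), ((-1 : ℂ) ^ k * p.choose k) * (N + k).choose p = (-1) ^ p := by
  rw [sum_neg_one_pow_mul_choose_mul_choose,
    show (fwdDiff 1)^[p] (fun x : ℕ => (x.choose p : ℤ)) = fun _ => 1 by
      simpa using fwdDiff_iter_choose 0 p]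
  simp

theorem DirTree.IsDirichletShift.sum_apply_evec {V : Type} {T : DirTree V} {hT : T.LocFin}
    {S : l2 V →L[ℂ] l2 V} {p : ℕ} (hL : T.Leafless)
    (hS : T.IsDirichletShift hT ((p + 1 : ℕ) : ℝ) S) (m : ℕ) (v : V) :
    (∑ k ∈ Finset.range (m + 1), ((-1 : ℂ) ^ k * (m.choose k : ℂ)) •
        (adjoint S ^ k * S ^ k)) (evec v) =
      ((∑ k ∈ Finset.range (m + 1), ((-1 : ℂ) ^ k * m.choose k) *
        (T.depth v + p + k).choose p) / ((T.depth v + p).choose p : ℂ)) • evec v := by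
  rw [_root_.sum_apply, Finset.sum_div, Finset.sum_smul]
  refine Finset.sum_congr rfl fun k _ => ?_
  rw [_root_.smul_apply, hS.adjoint_pow_mul_pow_evec hL, smul_smul, mul_div_assoc]

theorem stmt_9 {V : Type} [Countable V] [Infinite V] (T : DirTree V)
    (hL : T.Leafless) (hT : T.LocFin) (q : ℕ) (hq : 1 ≤ q)
    (S : l2 V →L[ℂ] l2 V) (hS : T.IsDirichletShift hT (q : ℝ) S) :
    (∑ k ∈ Finset.range (q + 1), ((-1 : ℂ) ^ k * (q.choose k : ℂ)) •
        ((ContinuousLinearMap.adjoint S) ^ k * S ^ k)) = 0 ∧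
      (2 ≤ q → (∑ k ∈ Finset.range q, ((-1 : ℂ) ^ k * ((q - 1).choose k : ℂ)) •
        ((ContinuousLinearMap.adjoint S) ^ k * S ^ k)) ≠ 0) := by
  obtain ⟨p, rfl⟩ : ∃ p, q = p + 1 := ⟨q - 1, by lia⟩
  refine ⟨clm_eq_zero_of_evec fun v => ?_, fun _ h => ?_⟩
  · rw [hS.sum_apply_evec hL, sum_choose_eq_zero, zero_div, zero_smul]
  · rw [Nat.add_sub_cancel] at h
    have hroot := hS.sum_apply_evec hL p T.root
    rw [h, sum_choose_eq_neg_one_pow, T.depth_root] at hroot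
    refine evec_ne_zero T.root ((smul_eq_zero.1 hroot.symm).resolve_left ?_)
    simp

end
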